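/- arXiv:1710.01008 — 3 statements merged into one kernel-verified Lean document; each statement's English description precedes it below -/
import Mathlib

section
/- Let V be a module with a finite increasing filtration W, a refinement (M, φ) of W, and a finite decreasing filtration F. For any integers k and p, under the canonical isomorphism gr^M_k V ≅ gr^M_k (gr^W_{m(k)} V), the induced filtrations F on both sides coincide: F^p gr^M_k V corresponds to F^p gr^M_k gr^W_{m(k)} V. -/
section GrPrelude
variable {R : Type*} [CommRing R]
variable {Q : Type*} [AddCommGroup Q] [Module R Q]

/-- The subquotient `A / (A ∩ B)` of a module, for submodules `A B`. -/
abbrev GrSub (A B : Submodule R Q) := A ⧸ (B.comap A.subtype)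

/-- The image of a submodule `T` in the subquotient `GrSub A B` (induced filtration). -/
def imgIn (A B T : Submodule R Q) : Submodule R (GrSub A B) :=
  Submodule.map (B.comap A.subtype).mkQ ((T ⊓ A).comap A.subtype)

variable {S : Type*} [AddCommGroup S] [Module R S]

/-- The canonical map into a subquotient induced by a map with values in `A`. -/
def stepMap (A B : Submodule R Q) (g : S →ₗ[R] Q) (hA : ∀ s, g s ∈ A) :
    S →ₗ[R] GrSub A B :=
  (B.comap A.subtype).mkQ.comp (g.codRestrict A hA)

theorem stepMap_mem (A B T : Submodule R Q) (g : S →ₗ[R] Q) (hA : ∀ s, g s ∈ A)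
    (hT : ∀ s, g s ∈ T) (s : S) : stepMap A B g hA s ∈ imgIn A B T :=
  Submodule.mem_map.mpr
    ⟨g.codRestrict A hA s, Submodule.mem_comap.mpr (Submodule.mem_inf.mpr ⟨hT s, hA s⟩), rfl⟩

end GrPrelude

section
variable {R : Type*} [CommRing R] {V : Type*} [AddCommGroup V] [Module R V]

/-- The canonical map `M_k V → gr^M_k (gr^W_{m} V)`. -/
def canGrRefine (W M : ℤ → Submodule R V) (k m : ℤ)
    (hA : ∀ s : M k, (M k).subtype s ∈ W m) :
    (M k) →ₗ[R] GrSub (imgIn (W m) (W (m - 1)) (M k)) (imgIn (W m) (W (m - 1)) (M (k - 1))) :=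
  stepMap _ _ (stepMap (W m) (W (m - 1)) (M k).subtype hA)
    (stepMap_mem (W m) (W (m - 1)) (M k) (M k).subtype hA (fun s => s.2))

/-- If `B ≤ T`, the class of `x : A` lies in the image of `T` exactly when `x ∈ T`. -/
theorem mkQ_mem_imgIn_iff {R Q : Type*} [CommRing R] [AddCommGroup Q] [Module R Q]
    {A B T : Submodule R Q} (hBT : B ≤ T) (x : A) :
    (B.comap A.subtype).mkQ x ∈ imgIn A B T ↔ (x : Q) ∈ T := by
  constructor
  · rintro ⟨t, ht, htx⟩
    have hsub : (t : Q) - x ∈ B := (Submodule.Quotient.eq (B.comap A.subtype)).mp htx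
    simpa using T.sub_mem ht.1 (hBT hsub)
  · exact fun hx => ⟨x, ⟨hx, x.2⟩, rfl⟩

/-- Lemma 1.10 (lem:2): for a refinement `(M, φ)` of a finite increasing filtration `W`,
a finite decreasing filtration `F`, and `m = m(k)`, under the canonical isomorphism
`gr^M_k V ≅ gr^M_k gr^W_{m} V` (induced by the canonical surjective map
`canGrRefine`, which has kernel `M_{k-1}`), the induced filtrations `F` on both sides
coincide: the image of `F^p V ∩ M_k V` under the canonical map equals
`F^p (gr^M_k gr^W_{m} V)`. -/
theorem stmt2 (W M : ℤ → Submodule R V) (hW : Monotone W) (hM : Monotone M)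
    (hWbot : ∃ a, W a = ⊥) (hWtop : ∃ b, W b = ⊤)
    (hMbot : ∃ a, M a = ⊥) (hMtop : ∃ b, M b = ⊤)
    (F : ℤ → Submodule R V) (hF : Antitone F)
    (hFbot : ∃ a, F a = ⊥) (hFtop : ∃ b, F b = ⊤)
    (φ : ℤ → ℤ) (hφ : StrictMono φ) (href : ∀ m, W m = M (φ m))
    (k m p : ℤ) (h1 : φ (m - 1) < k) (h2 : k ≤ φ m) :
    Function.Surjective
        (canGrRefine W M k m (fun s => by rw [href m]; exact hM h2 s.2)) ∧
      LinearMap.ker (canGrRefine W M k m (fun s => by rw [href m]; exact hM h2 s.2)) =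
        (M (k - 1)).comap (M k).subtype ∧
      Submodule.map (canGrRefine W M k m (fun s => by rw [href m]; exact hM h2 s.2))
          ((F p).comap (M k).subtype) =
        imgIn (imgIn (W m) (W (m - 1)) (M k)) (imgIn (W m) (W (m - 1)) (M (k - 1)))
          (imgIn (W m) (W (m - 1)) (F p)) := by
  have hN : W (m - 1) ≤ M (k - 1) := by
    rw [href]
    exact hM (by omega)
  have hN' : W (m - 1) ≤ M k := hN.trans (hM (by omega))
  refine ⟨?_, ?_, ?_⟩
  · intro z
    obtain ⟨⟨_, t, ht, rfl⟩, rfl⟩ := Submodule.mkQ_surjective _ z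
    exact ⟨⟨t, ht.1⟩, rfl⟩
  · ext s
    exact (Submodule.Quotient.mk_eq_zero _).trans (mkQ_mem_imgIn_iff hN _)
  · apply le_antisymm
    · rintro _ ⟨s, hs, rfl⟩
      have hsW : (s : V) ∈ W m := by
        rw [href m]
        exact hM h2 s.2
      have hsM := stepMap_mem (W m) (W (m - 1)) (M k) (M k).subtype
        (fun t => by rw [href m]; exact hM h2 t.2) (fun t => t.2) s
      exact ⟨⟨_, hsM⟩, ⟨⟨⟨s, hsW⟩, ⟨hs, hsW⟩, rfl⟩, hsM⟩, rfl⟩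
    · rintro _ ⟨⟨_, hy⟩, ⟨⟨t, ht, rfl⟩, -⟩, rfl⟩
      exact ⟨⟨t, (mkQ_mem_imgIn_iff hN' t).mp hy⟩, ht.1, rfl⟩

end
end

section
/- Let V be a module with a finite increasing filtration W, a refinement (M, φ) of W, and a finite decreasing filtration F. Then the canonical map F^p V ∩ M_k V → F^p(gr^W_{m(k)} V) ∩ M_k(gr^W_{m(k)} V) is surjective, where m(k) satisfies φ(m(k)-1) < k ≤ φ(m(k)). -/
section
variable {R : Type*} [CommRing R] {V : Type*} [AddCommGroup V] [Module R V]

theorem imgIn_inf_eq_of_le {A B N : Submodule R V} (T : Submodule R V) (hBN : B ≤ N) :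
    imgIn A B (T ⊓ N) = imgIn A B T ⊓ imgIn A B N := by
  apply le_antisymm
  · exact le_inf
      (Submodule.map_mono (Submodule.comap_mono (inf_le_inf_right A inf_le_left)))
      (Submodule.map_mono (Submodule.comap_mono (inf_le_inf_right A inf_le_right)))
  · rintro _ ⟨⟨x, hx, rfl⟩, ⟨y, hy, hxy⟩⟩
    have hB : (y : V) - x ∈ B := by
      simpa using (Submodule.Quotient.eq _).mp hxy
    have hxN : (x : V) ∈ N := by
      simpa using N.sub_mem hy.1 (hBN hB)
    exact ⟨x, ⟨⟨hx.1, hxN⟩, hx.2⟩, rfl⟩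

/-- The surjectivity statement (eq:13) in Lemma 1.10: for a refinement `(M, φ)` of a
finite increasing filtration `W`, a finite decreasing filtration `F`, and `m = m(k)`
(i.e. `φ(m-1) < k ≤ φ(m)`), the canonical map
`F^p V ∩ M_k V → F^p(gr^W_{m} V) ∩ M_k(gr^W_{m} V)` is surjective; equivalently the
image of `F^p V ∩ M_k V` in `gr^W_m V` equals the intersection of the images of
`F^p V` and of `M_k V`. -/
theorem stmt3 (W M : ℤ → Submodule R V) (hW : Monotone W) (hM : Monotone M)
    (hWbot : ∃ a, W a = ⊥) (hWtop : ∃ b, W b = ⊤)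
    (hMbot : ∃ a, M a = ⊥) (hMtop : ∃ b, M b = ⊤)
    (F : ℤ → Submodule R V) (hF : Antitone F)
    (hFbot : ∃ a, F a = ⊥) (hFtop : ∃ b, F b = ⊤)
    (φ : ℤ → ℤ) (hφ : StrictMono φ) (href : ∀ m, W m = M (φ m))
    (k m p : ℤ) (h1 : φ (m - 1) < k) (h2 : k ≤ φ m) :
    imgIn (W m) (W (m - 1)) (F p ⊓ M k) =
      imgIn (W m) (W (m - 1)) (F p) ⊓ imgIn (W m) (W (m - 1)) (M k) := by
  exact imgIn_inf_eq_of_le (F p) ((href (m - 1)).trans_le (hM h1.le))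

end
end

section
/- Let V be a module with a finite increasing filtration W, a refinement (M, φ) of W, and a finite decreasing filtration F. Then under the canonical identification gr^F_p gr^W_{m(k)} V ≅ gr^W_{m(k)} gr^F_p V (Zassenhaus), the induced submodules M_k(gr^F_p gr^W_{m(k)} V) and M_k(gr^W_{m(k)} gr^F_p V) coincide, for all k and p. -/
section SubquotientImages

variable {R : Type*} [CommRing R]
variable {Q : Type*} [AddCommGroup Q] [Module R Q]
variable {S : Type*} [AddCommGroup S] [Module R S]

theorem stepMap_mem_imgIn_iff (A B T : Submodule R Q) (g : S →ₗ[R] Q) (hA : ∀ s, g s ∈ A)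
    (s : S) : stepMap A B g hA s ∈ imgIn A B T ↔ ∃ t ∈ T, t ∈ A ∧ g s - t ∈ B := by
  constructor
  · rintro ⟨⟨t, htA⟩, ht, h⟩
    refine ⟨t, ht.1, htA, ?_⟩
    exact (Submodule.Quotient.eq (B.comap A.subtype)).mp h.symm
  · rintro ⟨t, ht, htA, h⟩
    exact ⟨⟨t, htA⟩, ⟨ht, htA⟩, ((Submodule.Quotient.eq (B.comap A.subtype)).mpr h).symm⟩

theorem ker_stepMap (A B : Submodule R Q) (g : S →ₗ[R] Q) (hA : ∀ s, g s ∈ A) :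
    LinearMap.ker (stepMap A B g hA) = B.comap g := by
  ext s
  exact Submodule.Quotient.mk_eq_zero _

theorem map_stepMap (A B : Submodule R Q) (g : S →ₗ[R] Q) (hA : ∀ s, g s ∈ A)
    (U : Submodule R S) : U.map (stepMap A B g hA) = imgIn A B (U.map g) := by
  apply le_antisymm
  · rintro _ ⟨s, hs, rfl⟩
    exact ⟨⟨g s, hA s⟩, ⟨⟨s, hs, rfl⟩, hA s⟩, rfl⟩
  · rintro _ ⟨⟨_, _⟩, ⟨⟨s, hs, rfl⟩, _⟩, rfl⟩
    exact ⟨s, hs, rfl⟩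

theorem imgIn_inf_left (A B T : Submodule R Q) : imgIn A B (T ⊓ A) = imgIn A B T := by
  simp only [imgIn, inf_assoc, inf_idem]

theorem imgIn_self (A B : Submodule R Q) : imgIn A B A = ⊤ := by
  simp [imgIn]

theorem imgIn_top (A B : Submodule R Q) : imgIn A B ⊤ = ⊤ := by
  simp [imgIn]

theorem imgIn_inf_of_le {A B X : Submodule R Q} (T : Submodule R Q) (h : B ≤ X) :
    imgIn A B (X ⊓ T) = imgIn A B X ⊓ imgIn A B T := by
  apply le_antisymm
  · rintro _ ⟨a, ha, rfl⟩
    exact ⟨⟨a, ⟨ha.1.1, ha.2⟩, rfl⟩, ⟨a, ⟨ha.1.2, ha.2⟩, rfl⟩⟩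
  · rintro _ ⟨⟨x, hx, rfl⟩, ⟨t, ht, hxt⟩⟩
    have hd : (t : Q) - x ∈ B := (Submodule.Quotient.eq (B.comap A.subtype)).mp hxt
    refine ⟨t, ⟨⟨?_, ht.1⟩, ht.2⟩, hxt⟩
    simpa using X.add_mem (h hd) hx.1

end SubquotientImages

section
variable {R : Type*} [CommRing R] {V : Type*} [AddCommGroup V] [Module R V]

/-- The canonical surjection `F^p V ∩ W_m V → gr_F^p (gr^W_m V)`. -/
def canFW (W F : ℤ → Submodule R V) (m p : ℤ) :
    (F p ⊓ W m : Submodule R V) →ₗ[R]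
      GrSub (imgIn (W m) (W (m - 1)) (F p)) (imgIn (W m) (W (m - 1)) (F (p + 1))) :=
  stepMap _ _ (stepMap (W m) (W (m - 1)) (F p ⊓ W m).subtype (fun s => s.2.2))
    (stepMap_mem (W m) (W (m - 1)) (F p) (F p ⊓ W m).subtype (fun s => s.2.2)
      (fun s => s.2.1))

/-- The canonical surjection `F^p V ∩ W_m V → gr^W_m (gr_F^p V)`. -/
def canWF (W F : ℤ → Submodule R V) (m p : ℤ) :
    (F p ⊓ W m : Submodule R V) →ₗ[R]
      GrSub (imgIn (F p) (F (p + 1)) (W m)) (imgIn (F p) (F (p + 1)) (W (m - 1))) :=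
  stepMap _ _ (stepMap (F p) (F (p + 1)) (F p ⊓ W m).subtype (fun s => s.2.1))
    (stepMap_mem (F p) (F (p + 1)) (W m) (F p ⊓ W m).subtype (fun s => s.2.1)
      (fun s => s.2.2))

theorem ker_canFW_eq_ker_canWF {W F : ℤ → Submodule R V} (hW : Monotone W) (hF : Antitone F)
    (m p : ℤ) : LinearMap.ker (canFW W F m p) = LinearMap.ker (canWF W F m p) := by
  have hW' : W (m - 1) ≤ W m := hW (by lia)
  have hF' : F (p + 1) ≤ F p := hF (by lia)
  rw [canFW, canWF, ker_stepMap, ker_stepMap]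
  ext s
  refine (stepMap_mem_imgIn_iff _ _ _ _ _ s).trans
    (Iff.trans ?_ (stepMap_mem_imgIn_iff _ _ _ _ _ s).symm)
  constructor
  · rintro ⟨t, ht, -, h⟩
    exact ⟨s - t, h, sub_mem s.2.1 (hF' ht), by simpa using ht⟩
  · rintro ⟨t, ht, -, h⟩
    exact ⟨s - t, h, sub_mem s.2.2 (hW' ht), by simpa using ht⟩

theorem map_canFW_comap {W F : ℤ → Submodule R V} {m : ℤ} (p : ℤ) {X : Submodule R V}
    (hX : W (m - 1) ≤ X) :
    (X.comap (F p ⊓ W m).subtype).map (canFW W F m p) =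
      imgIn (imgIn (W m) (W (m - 1)) (F p)) (imgIn (W m) (W (m - 1)) (F (p + 1)))
        (imgIn (W m) (W (m - 1)) X) := by
  refine (map_stepMap _ _ _ _ _).trans
    ((congrArg (imgIn _ _) (map_stepMap _ _ _ _ _)).trans ?_)
  rw [Submodule.map_comap_subtype,
    ← imgIn_inf_left _ _ (imgIn (W m) (W (m - 1)) X), ← imgIn_inf_of_le _ hX,
    ← imgIn_inf_left _ _ (X ⊓ F p)]
  congr 2
  ac_rfl

theorem map_canWF_comap (W F : ℤ → Submodule R V) {m : ℤ} (p : ℤ) {X : Submodule R V}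
    (hX : X ≤ W m) :
    (X.comap (F p ⊓ W m).subtype).map (canWF W F m p) =
      imgIn (imgIn (F p) (F (p + 1)) (W m)) (imgIn (F p) (F (p + 1)) (W (m - 1)))
        (imgIn (F p) (F (p + 1)) X) := by
  refine (map_stepMap _ _ _ _ _).trans
    ((congrArg (imgIn _ _) (map_stepMap _ _ _ _ _)).trans ?_)
  rw [Submodule.map_comap_subtype, inf_assoc,
    inf_eq_right.mpr hX, inf_comm, imgIn_inf_left]

theorem canFW_surjective {W : ℤ → Submodule R V} (hW : Monotone W) (F : ℤ → Submodule R V)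
    (m p : ℤ) : Function.Surjective (canFW W F m p) := by
  have h := map_canFW_comap (F := F) p (hW (show m - 1 ≤ m by lia))
  rw [imgIn_self, imgIn_top] at h
  exact LinearMap.range_eq_top.mp (top_unique (h ▸ LinearMap.map_le_range))

theorem canWF_surjective (W F : ℤ → Submodule R V) (m p : ℤ) :
    Function.Surjective (canWF W F m p) := by
  have h := map_canWF_comap W F p (le_refl (W m))
  rw [imgIn_self] at h
  exact LinearMap.range_eq_top.mp (top_unique (h ▸ LinearMap.map_le_range))

/-- The canonical isomorphism between the two iterated graded pieces of a pair of filtrations. -/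
noncomputable def zassenhausEquiv {W F : ℤ → Submodule R V} (hW : Monotone W) (hF : Antitone F)
    (m p : ℤ) :
    GrSub (imgIn (W m) (W (m - 1)) (F p)) (imgIn (W m) (W (m - 1)) (F (p + 1))) ≃ₗ[R]
      GrSub (imgIn (F p) (F (p + 1)) (W m)) (imgIn (F p) (F (p + 1)) (W (m - 1))) :=
  ((canFW W F m p).quotKerEquivOfSurjective (canFW_surjective hW F m p)).symm ≪≫ₗ
    Submodule.quotEquivOfEq _ _ (ker_canFW_eq_ker_canWF hW hF m p) ≪≫ₗ
      (canWF W F m p).quotKerEquivOfSurjective (canWF_surjective W F m p)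

theorem zassenhausEquiv_canFW {W F : ℤ → Submodule R V} (hW : Monotone W) (hF : Antitone F)
    (m p : ℤ) (s : (F p ⊓ W m : Submodule R V)) :
    zassenhausEquiv hW hF m p (canFW W F m p s) = canWF W F m p s := by
  have h : ((canFW W F m p).quotKerEquivOfSurjective (canFW_surjective hW F m p)).symm
      (canFW W F m p s) = Submodule.Quotient.mk s :=
    (LinearEquiv.symm_apply_eq _).mpr rfl
  simp only [zassenhausEquiv, LinearEquiv.trans_apply, h]
  rfl

/-- Lemma 1.12 (lem:3) and its corollary: for a refinement `(M, φ)` of a finite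
increasing filtration `W`, a finite decreasing filtration `F` and `m = m(k)`, under the
canonical (Zassenhaus) identification `gr_F^p gr^W_{m} V ≅ gr^W_{m} gr_F^p V`
(the linear equivalence `e` compatible with the canonical surjections from
`F^p V ∩ W_m V`), the induced submodules `M_k (gr_F^p gr^W_{m} V)` and
`M_k (gr^W_{m} gr_F^p V)` coincide. -/
theorem stmt4 (W M : ℤ → Submodule R V) (hW : Monotone W) (hM : Monotone M)
    (hWbot : ∃ a, W a = ⊥) (hWtop : ∃ b, W b = ⊤)
    (hMbot : ∃ a, M a = ⊥) (hMtop : ∃ b, M b = ⊤)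
    (F : ℤ → Submodule R V) (hF : Antitone F)
    (hFbot : ∃ a, F a = ⊥) (hFtop : ∃ b, F b = ⊤)
    (φ : ℤ → ℤ) (hφ : StrictMono φ) (href : ∀ m, W m = M (φ m))
    (k m p : ℤ) (h1 : φ (m - 1) < k) (h2 : k ≤ φ m) :
    ∃ e : GrSub (imgIn (W m) (W (m - 1)) (F p)) (imgIn (W m) (W (m - 1)) (F (p + 1))) ≃ₗ[R]
        GrSub (imgIn (F p) (F (p + 1)) (W m)) (imgIn (F p) (F (p + 1)) (W (m - 1))),
      (∀ s, e (canFW W F m p s) = canWF W F m p s) ∧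
      Submodule.map (e : _ →ₗ[R] _)
          (imgIn (imgIn (W m) (W (m - 1)) (F p)) (imgIn (W m) (W (m - 1)) (F (p + 1)))
            (imgIn (W m) (W (m - 1)) (M k))) =
        imgIn (imgIn (F p) (F (p + 1)) (W m)) (imgIn (F p) (F (p + 1)) (W (m - 1)))
          (imgIn (F p) (F (p + 1)) (M k)) := by
  have hX : W (m - 1) ≤ M k := href (m - 1) ▸ hM h1.le
  have hX' : M k ≤ W m := href m ▸ hM h2
  refine ⟨zassenhausEquiv hW hF m p, zassenhausEquiv_canFW hW hF m p, ?_⟩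
  rw [← map_canFW_comap p hX, ← map_canWF_comap W F p hX', ← Submodule.map_comp]
  congr 1
  exact LinearMap.ext (zassenhausEquiv_canFW hW hF m p)

end
end
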